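/- arXiv:2605.09569 — 2 statements merged into one kernel-verified Lean document; each statement's English description precedes it below -/
import Mathlib

section
/- (Recovery of the Butucea–Ingster rate.) Fix η ∈ (0,1) and constants 0 < a ≤ b. There exist constants c, C > 0 depending only on η, a, b such that for all positive integers d₁, d₂ and integers 1 ≤ s₁ ≤ d₁, 1 ≤ s₂ ≤ d₂ satisfying (i) e ≤ min(d₁/s₁, d₂/s₂), (ii) log log(d₁/s₁) ≤ log(d₂/s₂) and log log(d₂/s₂) ≤ log(d₁/s₁), and (iii) a·s₂·log(d₂/s₂) ≤ s₁·log(d₁/s₁) ≤ b·s₂·log(d₂/s₂), the minimax separation rate satisfies c·T ≤ (μ*)² ≤ C·T, where T = min( d₁d₂/(s₁²s₂²), (1/s₂)·log(d₁/s₁) + (1/s₁)·log(d₂/s₂) ). -/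
open MeasureTheory ProbabilityTheory

noncomputable def Pmeas (d₁ d₂ : ℕ) (X : Fin d₁ → Fin d₂ → ℝ) :
    Measure (Fin d₁ → Fin d₂ → ℝ) :=
  Measure.pi fun i => Measure.pi fun j => gaussianReal (X i j) 1

def Theta (d₁ d₂ s₁ s₂ : ℕ) (μ : ℝ) : Set (Fin d₁ → Fin d₂ → ℝ) :=
  {X | ∃ (S₁ : Finset (Fin d₁)) (S₂ : Finset (Fin d₂)),
    S₁.card = s₁ ∧ S₂.card = s₂ ∧
    (∀ i j, i ∈ S₁ → j ∈ S₂ → μ ≤ X i j) ∧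
    (∀ i j, ¬(i ∈ S₁ ∧ j ∈ S₂) → X i j = 0)}

noncomputable def risk (d₁ d₂ s₁ s₂ : ℕ) (μ : ℝ)
    (Δ : (Fin d₁ → Fin d₂ → ℝ) → Bool) : ℝ :=
  (Pmeas d₁ d₂ 0 {y | Δ y = true}).toReal +
    ⨆ X ∈ Theta d₁ d₂ s₁ s₂ μ, (Pmeas d₁ d₂ X {y | Δ y = false}).toReal

noncomputable def muStar (η : ℝ) (d₁ d₂ s₁ s₂ : ℕ) : ℝ :=
  sInf {μ : ℝ | 0 < μ ∧ ∃ Δ : (Fin d₁ → Fin d₂ → ℝ) → Bool,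
    Measurable Δ ∧ risk d₁ d₂ s₁ s₂ μ Δ < η}

/-! ### Likelihood ratios of Gaussian product measures -/

theorem pi_withDensity_prod {ι : Type*} [Fintype ι] {α : ι → Type*} [∀ i, MeasurableSpace (α i)]
    (ν : ∀ i, Measure (α i)) [∀ i, IsProbabilityMeasure (ν i)]
    (f : ∀ i, α i → ENNReal) (hf : ∀ i, Measurable (f i))
    [∀ i, SigmaFinite ((ν i).withDensity (f i))] :
    Measure.pi (fun i => (ν i).withDensity (f i)) =
      (Measure.pi ν).withDensity (fun x => ∏ i, f i (x i)) := by
  refine Measure.pi_eq fun s hs => ?_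
  have hm : ∀ i, Measurable ((s i).indicator (f i)) := fun i => (hf i).indicator (hs i)
  have hind : iIndepFun (fun i x => (s i).indicator (f i) (x i)) (Measure.pi ν) :=
    iIndepFun_pi fun i => (hm i).aemeasurable
  rw [withDensity_apply _ (MeasurableSet.univ_pi hs), ← lintegral_indicator (MeasurableSet.univ_pi hs)]
  calc ∫⁻ x, (Set.univ.pi s).indicator (fun x => ∏ i, f i (x i)) x ∂Measure.pi ν
      = ∫⁻ x, ∏ i, (s i).indicator (f i) (x i) ∂Measure.pi ν := by
        refine lintegral_congr fun x => ?_
        by_cases hx : x ∈ Set.univ.pi s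
        · rw [Set.indicator_of_mem hx]
          exact Finset.prod_congr rfl fun i _ =>
            (Set.indicator_of_mem (hx i (Set.mem_univ i)) _).symm
        · rw [Set.indicator_of_notMem hx]
          obtain ⟨i, hi⟩ : ∃ i, x i ∉ s i := by simpa [Set.mem_pi] using hx
          exact (Finset.prod_eq_zero (Finset.mem_univ i) (Set.indicator_of_notMem hi _)).symm
    _ = ∏ i, ∫⁻ x, (s i).indicator (f i) (x i) ∂Measure.pi ν :=
        lintegral_prod_eq_prod_lintegral_of_indepFun _ _ hind
          fun i => (hm i).comp (measurable_pi_apply i)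
    _ = ∏ i, (ν i).withDensity (f i) (s i) := by
        refine Finset.prod_congr rfl fun i _ => ?_
        rw [withDensity_apply _ (hs i), ← lintegral_indicator (hs i)]
        exact (measurePreserving_eval ν i).lintegral_comp (hm i)

theorem gaussianReal_eq_withDensity (m : ℝ) :
    gaussianReal m 1 =
      (gaussianReal 0 1).withDensity fun x => ENNReal.ofReal (Real.exp (m * x - m * m / 2)) := by
  rw [gaussianReal_of_var_ne_zero m one_ne_zero, gaussianReal_of_var_ne_zero 0 one_ne_zero,
    ← withDensity_mul _ (measurable_gaussianPDF 0 1) (by fun_prop)]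
  congr 1
  funext x
  simp only [Pi.mul_apply, gaussianPDF, gaussianPDFReal]
  rw [← ENNReal.ofReal_mul (by positivity), mul_assoc _ (Real.exp _) (Real.exp _), ← Real.exp_add]
  congr 3
  push_cast
  ring

/-- The entrywise (Frobenius) inner product of two matrices. -/
def frob {d₁ d₂ : ℕ} (w y : Fin d₁ → Fin d₂ → ℝ) : ℝ := ∑ i, ∑ j, w i j * y i j

@[fun_prop]
theorem measurable_frob {d₁ d₂ : ℕ} (w : Fin d₁ → Fin d₂ → ℝ) : Measurable (frob w) := by
  unfold frob
  fun_prop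

theorem frob_comm {d₁ d₂ : ℕ} (w y : Fin d₁ → Fin d₂ → ℝ) : frob w y = frob y w := by
  simp only [frob, mul_comm]

theorem frob_add_left {d₁ d₂ : ℕ} (v w y : Fin d₁ → Fin d₂ → ℝ) :
    frob (v + w) y = frob v y + frob w y := by
  simp only [frob, Pi.add_apply, add_mul, Finset.sum_add_distrib]

theorem frob_add_right {d₁ d₂ : ℕ} (v w y : Fin d₁ → Fin d₂ → ℝ) :
    frob v (w + y) = frob v w + frob v y := by
  rw [frob_comm, frob_add_left, frob_comm w, frob_comm y]

theorem frob_smul_left {d₁ d₂ : ℕ} (c : ℝ) (w y : Fin d₁ → Fin d₂ → ℝ) :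
    frob (c • w) y = c * frob w y := by
  simp only [frob, Pi.smul_apply, smul_eq_mul, Finset.mul_sum, mul_assoc]

theorem frob_smul_right {d₁ d₂ : ℕ} (c : ℝ) (w y : Fin d₁ → Fin d₂ → ℝ) :
    frob w (c • y) = c * frob w y := by
  rw [frob_comm, frob_smul_left, frob_comm]

theorem frob_zero_right {d₁ d₂ : ℕ} (w : Fin d₁ → Fin d₂ → ℝ) : frob w 0 = 0 := by
  simp [frob]

/-- The likelihood ratio of `Pmeas d₁ d₂ X` with respect to `Pmeas d₁ d₂ 0`. -/
noncomputable def likelihood {d₁ d₂ : ℕ} (X y : Fin d₁ → Fin d₂ → ℝ) : ℝ :=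
  Real.exp (frob X y - frob X X / 2)

@[fun_prop]
theorem measurable_likelihood {d₁ d₂ : ℕ} (X : Fin d₁ → Fin d₂ → ℝ) :
    Measurable (likelihood X) := by
  unfold likelihood
  fun_prop

theorem likelihood_nonneg {d₁ d₂ : ℕ} (X y : Fin d₁ → Fin d₂ → ℝ) : 0 ≤ likelihood X y :=
  (Real.exp_pos _).le

instance {d₁ d₂ : ℕ} (X : Fin d₁ → Fin d₂ → ℝ) : IsProbabilityMeasure (Pmeas d₁ d₂ X) := by
  unfold Pmeas
  infer_instance

theorem Pmeas_eq_withDensity {d₁ d₂ : ℕ} (X : Fin d₁ → Fin d₂ → ℝ) :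
    Pmeas d₁ d₂ X =
      (Pmeas d₁ d₂ 0).withDensity fun y => ENNReal.ofReal (likelihood X y) := by
  have hrow : ∀ i, (Measure.pi fun j => gaussianReal (X i j) 1) =
      (Measure.pi fun _ : Fin d₂ => gaussianReal 0 1).withDensity fun x =>
        ∏ j, ENNReal.ofReal (Real.exp (X i j * x j - X i j * X i j / 2)) := by
    intro i
    have hsf : ∀ j, SigmaFinite ((gaussianReal 0 1).withDensity fun x =>
        ENNReal.ofReal (Real.exp (X i j * x - X i j * X i j / 2))) := fun j => by
      rw [← gaussianReal_eq_withDensity]; infer_instance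
    rw [← pi_withDensity_prod (fun _ : Fin d₂ => gaussianReal 0 1)
      (fun j x => ENNReal.ofReal (Real.exp (X i j * x - X i j * X i j / 2)))
      (fun j => by fun_prop)]
    simp only [← gaussianReal_eq_withDensity]
  have hsf : ∀ i, SigmaFinite ((Measure.pi fun _ : Fin d₂ => gaussianReal 0 1).withDensity
      fun x => ∏ j, ENNReal.ofReal (Real.exp (X i j * x j - X i j * X i j / 2))) := fun i => by
    rw [← hrow]; infer_instance
  unfold Pmeas
  simp only [hrow]
  rw [pi_withDensity_prod _ _ (fun i => by fun_prop)]
  simp only [Pi.zero_apply]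
  congr 1
  funext y
  simp only [← ENNReal.ofReal_prod_of_nonneg (fun _ _ => (Real.exp_pos _).le),
    ← Real.exp_sum]
  simp only [likelihood, frob, Finset.sum_sub_distrib, Finset.sum_div]

theorem lintegral_likelihood {d₁ d₂ : ℕ} (X : Fin d₁ → Fin d₂ → ℝ) :
    ∫⁻ y, ENNReal.ofReal (likelihood X y) ∂Pmeas d₁ d₂ 0 = 1 := by
  have h : Pmeas d₁ d₂ X Set.univ = 1 := measure_univ
  rwa [Pmeas_eq_withDensity, withDensity_apply _ MeasurableSet.univ, Measure.restrict_univ] at h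

theorem integrable_likelihood {d₁ d₂ : ℕ} (X : Fin d₁ → Fin d₂ → ℝ) :
    Integrable (likelihood X) (Pmeas d₁ d₂ 0) := by
  refine ⟨(measurable_likelihood X).aestronglyMeasurable, ?_⟩
  rw [hasFiniteIntegral_iff_ofReal (ae_of_all _ (likelihood_nonneg X)), lintegral_likelihood]
  exact ENNReal.one_lt_top

theorem integral_likelihood {d₁ d₂ : ℕ} (X : Fin d₁ → Fin d₂ → ℝ) :
    ∫ y, likelihood X y ∂Pmeas d₁ d₂ 0 = 1 := by
  rw [integral_eq_lintegral_of_nonneg_ae (ae_of_all _ (likelihood_nonneg X))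
    (measurable_likelihood X).aestronglyMeasurable, lintegral_likelihood, ENNReal.toReal_one]

theorem Pmeas_toReal_eq_setIntegral {d₁ d₂ : ℕ} (X : Fin d₁ → Fin d₂ → ℝ)
    {A : Set (Fin d₁ → Fin d₂ → ℝ)} (hA : MeasurableSet A) :
    (Pmeas d₁ d₂ X A).toReal = ∫ y in A, likelihood X y ∂Pmeas d₁ d₂ 0 := by
  rw [integral_eq_lintegral_of_nonneg_ae (ae_of_all _ (likelihood_nonneg X))
    (measurable_likelihood X).aestronglyMeasurable, Pmeas_eq_withDensity X,
    withDensity_apply _ hA]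

theorem likelihood_mul {d₁ d₂ : ℕ} (X X' y : Fin d₁ → Fin d₂ → ℝ) :
    likelihood X y * likelihood X' y = Real.exp (frob X X') * likelihood (X + X') y := by
  simp only [likelihood, ← Real.exp_add, frob_add_left, frob_add_right, frob_comm X' X]
  congr 1
  ring

/-- Chernoff bound for a linear statistic of the observation. -/
theorem Pmeas_frob_ge_le {d₁ d₂ : ℕ} (X w : Fin d₁ → Fin d₂ → ℝ) (t : ℝ) :
    (Pmeas d₁ d₂ X {y | t ≤ frob w y}).toReal ≤ Real.exp (frob w X + frob w w / 2 - t) := by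
  have hA : MeasurableSet {y | t ≤ frob w y} := measurableSet_le measurable_const (measurable_frob w)
  rw [Pmeas_toReal_eq_setIntegral X hA]
  have hint := (integrable_likelihood (X + w)).const_mul (Real.exp (frob w X + frob w w / 2 - t))
  calc ∫ y in {y | t ≤ frob w y}, likelihood X y ∂Pmeas d₁ d₂ 0
      ≤ ∫ y in {y | t ≤ frob w y},
          Real.exp (frob w X + frob w w / 2 - t) * likelihood (X + w) y ∂Pmeas d₁ d₂ 0 := by
        refine setIntegral_mono_on (integrable_likelihood X).integrableOn hint.integrableOn hA ?_
        intro y hy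
        simp only [Set.mem_ofPred_eq] at hy
        simp only [likelihood, ← Real.exp_add, frob_add_left, frob_add_right, frob_comm X w]
        apply Real.exp_le_exp.2
        linarith
    _ ≤ ∫ y, Real.exp (frob w X + frob w w / 2 - t) * likelihood (X + w) y ∂Pmeas d₁ d₂ 0 :=
        setIntegral_le_integral hint (ae_of_all _ fun y =>
          mul_nonneg (Real.exp_pos _).le (likelihood_nonneg _ y))
    _ = Real.exp (frob w X + frob w w / 2 - t) := by
        rw [integral_const_mul, integral_likelihood, mul_one]

/-! ### Bounds on the risk of a test -/

theorem risk_le {d₁ d₂ s₁ s₂ : ℕ} {μ α β : ℝ} {Δ : (Fin d₁ → Fin d₂ → ℝ) → Bool}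
    (hα : (Pmeas d₁ d₂ 0 {y | Δ y = true}).toReal ≤ α) (hβ0 : 0 ≤ β)
    (hβ : ∀ X ∈ Theta d₁ d₂ s₁ s₂ μ, (Pmeas d₁ d₂ X {y | Δ y = false}).toReal ≤ β) :
    risk d₁ d₂ s₁ s₂ μ Δ ≤ α + β :=
  add_le_add hα (Real.iSup_le (fun X => Real.iSup_le (fun hX => hβ X hX) hβ0) hβ0)

theorem le_risk {d₁ d₂ s₁ s₂ : ℕ} {μ : ℝ} (Δ : (Fin d₁ → Fin d₂ → ℝ) → Bool)
    {X : Fin d₁ → Fin d₂ → ℝ} (hX : X ∈ Theta d₁ d₂ s₁ s₂ μ) :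
    (Pmeas d₁ d₂ 0 {y | Δ y = true}).toReal + (Pmeas d₁ d₂ X {y | Δ y = false}).toReal ≤
      risk d₁ d₂ s₁ s₂ μ Δ := by
  have hone : ∀ Y, (Pmeas d₁ d₂ Y {y | Δ y = false}).toReal ≤ 1 := fun Y =>
    measureReal_le_one (μ := Pmeas d₁ d₂ Y)
  refine add_le_add le_rfl ?_
  refine le_ciSup_of_le ⟨1, ?_⟩ X ?_
  · rintro _ ⟨Y, rfl⟩
    exact Real.iSup_le (fun _ => hone Y) zero_le_one
  · rw [ciSup_pos hX]

/-- Le Cam's two-point method with a uniform mixture: a small `χ²` divergence between the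
mixture and the null forces a large risk. -/
theorem one_sub_le_risk {d₁ d₂ s₁ s₂ : ℕ} {μ ε : ℝ} (hε : 0 < ε)
    {Δ : (Fin d₁ → Fin d₂ → ℝ) → Bool} (hΔ : Measurable Δ)
    {ι : Type*} [Fintype ι] [Nonempty ι] (X : ι → Fin d₁ → Fin d₂ → ℝ)
    (hX : ∀ i, X i ∈ Theta d₁ d₂ s₁ s₂ μ)
    (hχ : ∑ i, ∑ j, Real.exp (frob (X i) (X j)) ≤ (1 + ε ^ 2) * (Fintype.card ι : ℝ) ^ 2) :
    1 - ε ≤ risk d₁ d₂ s₁ s₂ μ Δ := by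
  set n : ℝ := (Fintype.card ι : ℝ) with hn
  have hn0 : 0 < n := by
    rw [hn]
    exact_mod_cast Fintype.card_pos
  set A : Set (Fin d₁ → Fin d₂ → ℝ) := {y | Δ y = false} with hA
  have hAm : MeasurableSet A := hΔ (measurableSet_singleton false)
  set L : (Fin d₁ → Fin d₂ → ℝ) → ℝ := fun y => n⁻¹ * ∑ i, likelihood (X i) y with hL
  set G : (Fin d₁ → Fin d₂ → ℝ) → ℝ := fun y =>
    (n ^ 2)⁻¹ * ∑ i, ∑ j, Real.exp (frob (X i) (X j)) * likelihood (X i + X j) y with hG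
  have hLi : Integrable L (Pmeas d₁ d₂ 0) :=
    (integrable_finsetSum _ fun i _ => integrable_likelihood (X i)).const_mul _
  have hGi : Integrable G (Pmeas d₁ d₂ 0) :=
    (integrable_finsetSum _ fun i _ => integrable_finsetSum _ fun j _ =>
      (integrable_likelihood (X i + X j)).const_mul _).const_mul _
  have hGL : ∀ y, G y = L y ^ 2 := fun y => by
    simp only [hG, hL, ← likelihood_mul, mul_pow, inv_pow]
    rw [sq (∑ i, likelihood (X i) y), Finset.sum_mul_sum]
  have hLint : ∫ y, L y ∂Pmeas d₁ d₂ 0 = 1 := by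
    simp only [hL]
    rw [integral_const_mul, integral_finsetSum _ fun i _ => integrable_likelihood (X i)]
    simp only [integral_likelihood, Finset.sum_const, Finset.card_univ, nsmul_eq_mul, mul_one]
    exact inv_mul_cancel₀ hn0.ne'
  have hGint : ∫ y, G y ∂Pmeas d₁ d₂ 0 ≤ 1 + ε ^ 2 := by
    simp only [hG]
    rw [integral_const_mul, integral_finsetSum _ fun i _ => integrable_finsetSum _ fun j _ =>
      (integrable_likelihood (X i + X j)).const_mul _]
    have : ∀ i, ∫ y, ∑ j, Real.exp (frob (X i) (X j)) * likelihood (X i + X j) y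
        ∂Pmeas d₁ d₂ 0 = ∑ j, Real.exp (frob (X i) (X j)) := fun i => by
      rw [integral_finsetSum _ fun j _ => (integrable_likelihood (X i + X j)).const_mul _]
      simp only [integral_const_mul, integral_likelihood, mul_one]
    simp only [this]
    rw [inv_mul_le_iff₀ (by positivity)]
    linarith
  have havg : ∫ y in A, L y ∂Pmeas d₁ d₂ 0 ≤
      risk d₁ d₂ s₁ s₂ μ Δ - (Pmeas d₁ d₂ 0 {y | Δ y = true}).toReal := by
    simp only [hL]
    rw [integral_const_mul, integral_finsetSum _ fun i _ => (integrable_likelihood (X i)).integrableOn,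
      inv_mul_le_iff₀ hn0]
    calc ∑ i, ∫ y in A, likelihood (X i) y ∂Pmeas d₁ d₂ 0
        ≤ ∑ _i : ι, (risk d₁ d₂ s₁ s₂ μ Δ - (Pmeas d₁ d₂ 0 {y | Δ y = true}).toReal) := by
          refine Finset.sum_le_sum fun i _ => ?_
          rw [← Pmeas_toReal_eq_setIntegral _ hAm]
          linarith [le_risk Δ (hX i)]
      _ = _ := by simp [hn, mul_sub]
  have hcompl : (Pmeas d₁ d₂ 0 {y | Δ y = true}).toReal = 1 - ∫ _y in A, (1 : ℝ) ∂Pmeas d₁ d₂ 0 := by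
    have : {y | Δ y = true} = Aᶜ := by ext y; simp [hA]
    rw [this, setIntegral_const, smul_eq_mul, mul_one]
    exact probReal_compl_eq_one_sub (μ := Pmeas d₁ d₂ 0) hAm
  have hbound : ∫ y in A, (1 - L y) ∂Pmeas d₁ d₂ 0 ≤ ε := by
    have hi : Integrable (fun y => (2 * ε)⁻¹ * (G y - 2 * L y + (1 + ε ^ 2))) (Pmeas d₁ d₂ 0) :=
      ((hGi.sub (hLi.const_mul 2)).add (integrable_const _)).const_mul _
    have hpt : ∀ y, (2 * ε)⁻¹ * (G y - 2 * L y + (1 + ε ^ 2)) - (1 - L y) =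
        (2 * ε)⁻¹ * (1 - L y - ε) ^ 2 := fun y => by
      rw [hGL]
      field_simp
      ring
    have hpt0 : ∀ y, 0 ≤ (2 * ε)⁻¹ * (G y - 2 * L y + (1 + ε ^ 2)) := fun y => by
      rw [hGL]
      have : L y ^ 2 - 2 * L y + (1 + ε ^ 2) = (L y - 1) ^ 2 + ε ^ 2 := by ring
      rw [this]
      positivity
    calc ∫ y in A, (1 - L y) ∂Pmeas d₁ d₂ 0
        ≤ ∫ y in A, (2 * ε)⁻¹ * (G y - 2 * L y + (1 + ε ^ 2)) ∂Pmeas d₁ d₂ 0 := by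
          refine setIntegral_mono ((integrable_const _).sub hLi).integrableOn hi.integrableOn ?_
          intro y
          have h1 := hpt y
          have h2 : 0 ≤ (2 * ε)⁻¹ * (1 - L y - ε) ^ 2 := by positivity
          simp only
          linarith
      _ ≤ ∫ y, (2 * ε)⁻¹ * (G y - 2 * L y + (1 + ε ^ 2)) ∂Pmeas d₁ d₂ 0 :=
          setIntegral_le_integral hi (ae_of_all _ hpt0)
      _ = (2 * ε)⁻¹ * (∫ y, G y ∂Pmeas d₁ d₂ 0 - 2 + (1 + ε ^ 2)) := by
          have hsub : Integrable (fun y => G y - 2 * L y) (Pmeas d₁ d₂ 0) :=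
            hGi.sub (hLi.const_mul 2)
          rw [integral_const_mul, integral_add hsub (integrable_const _),
            integral_sub hGi (hLi.const_mul 2), integral_const_mul 2 L, hLint]
          simp
      _ ≤ (2 * ε)⁻¹ * (2 * ε * ε) := by
          refine mul_le_mul_of_nonneg_left ?_ (by positivity)
          nlinarith
      _ = ε := by field_simp
  rw [integral_sub (integrable_const _).integrableOn hLi.integrableOn] at hbound
  linarith

/-- Risk of the test rejecting when the maximum of the linear statistics indexed by `𝒲`
exceeds `t`. -/
theorem exists_scan_test {d₁ d₂ s₁ s₂ : ℕ} {μ N t : ℝ} (hN : 0 < N) (ht : 0 ≤ t)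
    (𝒲 : Finset (Fin d₁ → Fin d₂ → ℝ)) (hW : ∀ w ∈ 𝒲, frob w w ≤ N)
    (hΘ : ∀ X ∈ Theta d₁ d₂ s₁ s₂ μ, ∃ w ∈ 𝒲, 2 * t ≤ frob w X) :
    ∃ Δ : (Fin d₁ → Fin d₂ → ℝ) → Bool, Measurable Δ ∧
      risk d₁ d₂ s₁ s₂ μ Δ ≤ 2 * (𝒲.card * Real.exp (-(t ^ 2 / (2 * N)))) := by
  classical
  have hrew : t / N * t = t ^ 2 / N := by ring
  have hset : ∀ w : Fin d₁ → Fin d₂ → ℝ, MeasurableSet {y | t ≤ frob w y} := fun w =>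
    measurableSet_le measurable_const (measurable_frob w)
  have hτ : 0 ≤ t / N := by positivity
  have hquad : ∀ w ∈ 𝒲, t / N * (t / N * frob w w) ≤ t ^ 2 / N := fun w hw => by
    calc t / N * (t / N * frob w w) ≤ t / N * (t / N * N) := by gcongr; exact hW w hw
      _ = t ^ 2 / N := by field_simp
  have htrue : {y | decide (∃ w ∈ 𝒲, t ≤ frob w y) = true} = ⋃ w ∈ 𝒲, {y | t ≤ frob w y} := by
    ext y
    simp
  have hhalf : t ^ 2 / (2 * N) = t ^ 2 / N / 2 := by rw [mul_comm, div_div]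
  refine ⟨fun y => decide (∃ w ∈ 𝒲, t ≤ frob w y), ?_, ?_⟩
  · refine measurable_to_bool ?_
    change MeasurableSet {y | decide (∃ w ∈ 𝒲, t ≤ frob w y) = true}
    rw [htrue]
    exact Finset.measurableSet_biUnion _ fun w _ => hset w
  · rw [two_mul]
    refine risk_le ?_ (by positivity) ?_
    · rw [htrue]
      calc (Pmeas d₁ d₂ 0 (⋃ w ∈ 𝒲, {y | t ≤ frob w y})).toReal
          ≤ ∑ w ∈ 𝒲, (Pmeas d₁ d₂ 0 {y | t ≤ frob w y}).toReal :=
            measureReal_biUnion_finset_le (μ := Pmeas d₁ d₂ 0) _ _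
        _ ≤ ∑ w ∈ 𝒲, Real.exp (-(t ^ 2 / (2 * N))) := by
            refine Finset.sum_le_sum fun w hw => ?_
            refine le_trans (measureReal_mono (μ := Pmeas d₁ d₂ 0)
              (s₂ := {y | t ^ 2 / N ≤ frob ((t / N) • w) y}) ?_) ?_
            · intro y hy
              simp only [Set.mem_ofPred_eq] at hy ⊢
              rw [frob_smul_left, ← hrew]
              gcongr
            · refine (Pmeas_frob_ge_le _ _ _).trans (Real.exp_le_exp.2 ?_)
              rw [frob_zero_right, frob_smul_left, frob_smul_right, hhalf]
              linarith [hquad w hw]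
        _ = 𝒲.card * Real.exp (-(t ^ 2 / (2 * N))) := by simp
    · intro X hX
      obtain ⟨w, hw, hwX⟩ := hΘ X hX
      have hcard : (1 : ℝ) ≤ 𝒲.card := by exact_mod_cast Finset.card_pos.2 ⟨w, hw⟩
      refine le_trans ?_ (le_mul_of_one_le_left (Real.exp_pos _).le hcard)
      refine le_trans (measureReal_mono (μ := Pmeas d₁ d₂ X)
        (s₂ := {y | -(t ^ 2 / N) ≤ frob ((-(t / N)) • w) y}) ?_) ?_
      · intro y hy
        simp only [Set.mem_ofPred_eq, decide_eq_false_iff_not, not_exists, not_and, not_le] at hy ⊢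
        have := mul_le_mul_of_nonneg_left (hy w hw).le hτ
        rw [frob_smul_left]
        linarith [hrew]
      · refine (Pmeas_frob_ge_le _ _ _).trans (Real.exp_le_exp.2 ?_)
        have := mul_le_mul_of_nonneg_left hwX hτ
        rw [frob_smul_left, frob_smul_left, frob_smul_right, hhalf]
        linarith [hquad w hw, hrew]

/-! ### Block matrices and the random block prior -/

/-- The matrix equal to `ν` on `S₁ ×ˢ S₂` and to `0` elsewhere. -/
noncomputable def blockMatrix {d₁ d₂ : ℕ} (ν : ℝ) (S₁ : Finset (Fin d₁)) (S₂ : Finset (Fin d₂)) :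
    Fin d₁ → Fin d₂ → ℝ :=
  fun i j => if i ∈ S₁ ∧ j ∈ S₂ then ν else 0

theorem frob_blockMatrix_left {d₁ d₂ : ℕ} (ν : ℝ) (S₁ : Finset (Fin d₁)) (S₂ : Finset (Fin d₂))
    (X : Fin d₁ → Fin d₂ → ℝ) :
    frob (blockMatrix ν S₁ S₂) X = ∑ i ∈ S₁, ∑ j ∈ S₂, ν * X i j := by
  simp only [frob, blockMatrix, ite_mul, zero_mul, ite_and]
  rw [← Finset.sum_filter_add_sum_filter_not Finset.univ (· ∈ S₁)]
  rw [Finset.sum_eq_zero (s := Finset.univ.filter fun i => ¬ i ∈ S₁) fun i hi => by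
    simp [(Finset.mem_filter.1 hi).2]]
  simp only [Finset.filter_univ_mem, add_zero]
  refine Finset.sum_congr rfl fun i hi => ?_
  simp [hi]

theorem frob_blockMatrix {d₁ d₂ : ℕ} (ν ν' : ℝ) (S₁ T₁ : Finset (Fin d₁))
    (S₂ T₂ : Finset (Fin d₂)) :
    frob (blockMatrix ν S₁ S₂) (blockMatrix ν' T₁ T₂) =
      ν * ν' * ((S₁ ∩ T₁).card * (S₂ ∩ T₂).card) := by
  rw [frob_blockMatrix_left]
  simp only [blockMatrix, ite_and, mul_ite, mul_zero]
  have : ∀ i, (∑ j ∈ S₂, if i ∈ T₁ then if j ∈ T₂ then ν * ν' else 0 else 0) =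
      if i ∈ T₁ then (S₂ ∩ T₂).card * (ν * ν') else 0 := fun i => by
    split_ifs
    · simp only [Finset.sum_ite_mem, Finset.sum_const, nsmul_eq_mul]
    · simp
  simp only [this, Finset.sum_ite_mem, Finset.sum_const, nsmul_eq_mul]
  ring

theorem blockMatrix_mem_Theta {d₁ d₂ : ℕ} (μ : ℝ) (S₁ : Finset (Fin d₁)) (S₂ : Finset (Fin d₂)) :
    blockMatrix μ S₁ S₂ ∈ Theta d₁ d₂ S₁.card S₂.card μ :=
  ⟨S₁, S₂, rfl, rfl, fun _ _ hi hj => by simp [blockMatrix, hi, hj],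
    fun _ _ h => by simp [blockMatrix, h]⟩

/-- The set with one element, selected by `f`, in each of `s` disjoint blocks of size `m`. -/
def transversal {s m d : ℕ} (e : Fin s × Fin m ↪ Fin d) (f : Fin s → Fin m) : Finset (Fin d) :=
  Finset.univ.map ⟨fun i => e (i, f i), fun _ _ h => (Prod.ext_iff.1 (e.injective h)).1⟩

/-- The number of coordinates on which two selections agree. -/
def agree {s m : ℕ} (f g : Fin s → Fin m) : ℕ := (Finset.univ.filter fun i => f i = g i).card

theorem agree_le {s m : ℕ} (f g : Fin s → Fin m) : agree f g ≤ s :=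
  (Finset.card_filter_le _ _).trans (by simp)

theorem card_transversal {s m d : ℕ} (e : Fin s × Fin m ↪ Fin d) (f : Fin s → Fin m) :
    (transversal e f).card = s := by
  simp [transversal]

theorem card_transversal_inter {s m d : ℕ} (e : Fin s × Fin m ↪ Fin d) (f g : Fin s → Fin m) :
    (transversal e f ∩ transversal e g).card = agree f g := by
  have : transversal e f ∩ transversal e g = (Finset.univ.filter fun i => f i = g i).map
      ⟨fun i => e (i, f i), fun _ _ h => (Prod.ext_iff.1 (e.injective h)).1⟩ := by
    ext x
    simp only [transversal, Finset.mem_inter, Finset.mem_map, Finset.mem_univ, true_and,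
      Finset.mem_filter]
    constructor
    · rintro ⟨⟨i, rfl⟩, j, hj⟩
      obtain ⟨rfl, h⟩ := Prod.ext_iff.1 (e.injective hj)
      exact ⟨j, h.symm, rfl⟩
    · rintro ⟨i, hi, rfl⟩
      exact ⟨⟨i, rfl⟩, i, congrArg (fun a => e (i, a)) hi.symm⟩
  rw [this, Finset.card_map, agree]

/-- Exponential moments of the number of agreements with a uniformly random selection. -/
theorem sum_exp_agree_le {s m : ℕ} (hm : 0 < m) (t : ℝ) (g : Fin s → Fin m) :
    ∑ f, Real.exp (t * agree f g) ≤
      (m : ℝ) ^ s * Real.exp (s * (1 / m) * (Real.exp t - 1)) := by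
  have hm' : (1 : ℝ) ≤ m := by exact_mod_cast hm
  have hm0 : (0 : ℝ) < m := by linarith
  have hexp : ∀ f : Fin s → Fin m,
      Real.exp (t * agree f g) = ∏ i, if f i = g i then Real.exp t else 1 := fun f => by
    rw [Finset.prod_ite, Finset.prod_const, Finset.prod_const_one, mul_one, ← Real.exp_nat_mul,
      agree, mul_comm]
  have hsum : ∀ i, ∑ a : Fin m, (if a = g i then Real.exp t else 1) = m - 1 + Real.exp t :=
    fun i => by
      have : ∀ a, (if a = g i then Real.exp t else 1) =
          1 + if a = g i then Real.exp t - 1 else 0 := fun a => by split_ifs <;> ring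
      simp only [this, Finset.sum_add_distrib, Finset.sum_ite_eq', Finset.mem_univ, if_true]
      simp
      ring
  calc ∑ f, Real.exp (t * agree f g)
      = ∏ i : Fin s, ∑ a : Fin m, (if a = g i then Real.exp t else 1) := by
        rw [Finset.prod_univ_sum, Fintype.piFinset_univ]
        exact Finset.sum_congr rfl fun f _ => hexp f
    _ = (m - 1 + Real.exp t) ^ s := by
        simp only [hsum, Finset.prod_const, Finset.card_univ, Fintype.card_fin]
    _ ≤ (m * Real.exp (1 / m * (Real.exp t - 1))) ^ s := by
        refine pow_le_pow_left₀ (by linarith [Real.exp_pos t]) ?_ _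
        have h := Real.add_one_le_exp (1 / m * (Real.exp t - 1))
        calc m - 1 + Real.exp t = m * (1 / m * (Real.exp t - 1) + 1) := by field_simp; ring
          _ ≤ _ := by gcongr
    _ = _ := by rw [mul_pow, ← Real.exp_nat_mul, mul_assoc]

/-- Second moment of the likelihood ratio of the random block prior. -/
theorem sum_exp_frob_transversal_le {s₁ s₂ m₁ m₂ d₁ d₂ : ℕ} (hm₁ : 0 < m₁) (hm₂ : 0 < m₂)
    (e₁ : Fin s₁ × Fin m₁ ↪ Fin d₁) (e₂ : Fin s₂ × Fin m₂ ↪ Fin d₂) {μ α θ R B : ℝ}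
    (hpt : ∀ k : ℕ, k ≤ s₂ → Real.exp (s₁ * (1 / m₁) * (Real.exp (μ ^ 2 * k) - 1)) ≤
      Real.exp (α * k) + R * Real.exp (θ * k)) (hR : 0 ≤ R)
    (hB : Real.exp (s₂ * (1 / m₂) * (Real.exp α - 1)) +
      R * Real.exp (s₂ * (1 / m₂) * (Real.exp θ - 1)) ≤ B) :
    ∑ p : (Fin s₁ → Fin m₁) × (Fin s₂ → Fin m₂), ∑ q : (Fin s₁ → Fin m₁) × (Fin s₂ → Fin m₂),
      Real.exp (frob (blockMatrix μ (transversal e₁ p.1) (transversal e₂ p.2))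
        (blockMatrix μ (transversal e₁ q.1) (transversal e₂ q.2))) ≤
      B * (Fintype.card ((Fin s₁ → Fin m₁) × (Fin s₂ → Fin m₂)) : ℝ) ^ 2 := by
  simp only [frob_blockMatrix, card_transversal_inter]
  rw [Finset.sum_comm]
  have hcard : (Fintype.card ((Fin s₁ → Fin m₁) × (Fin s₂ → Fin m₂)) : ℝ) =
      (m₁ : ℝ) ^ s₁ * (m₂ : ℝ) ^ s₂ := by simp
  have hq : ∀ q : (Fin s₁ → Fin m₁) × (Fin s₂ → Fin m₂),
      ∑ p : (Fin s₁ → Fin m₁) × (Fin s₂ → Fin m₂),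
        Real.exp (μ * μ * (agree p.1 q.1 * agree p.2 q.2)) ≤
      B * ((m₁ : ℝ) ^ s₁ * (m₂ : ℝ) ^ s₂) := fun q => by
    rw [Fintype.sum_prod_type_right]
    calc ∑ g : Fin s₂ → Fin m₂, ∑ f : Fin s₁ → Fin m₁,
          Real.exp (μ * μ * (agree f q.1 * agree g q.2))
        ≤ ∑ g : Fin s₂ → Fin m₂, (m₁ : ℝ) ^ s₁ *
            (Real.exp (α * agree g q.2) + R * Real.exp (θ * agree g q.2)) := by
          refine Finset.sum_le_sum fun g _ => ?_
          have h := sum_exp_agree_le hm₁ (μ ^ 2 * agree g q.2) q.1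
          have hc : ∀ f : Fin s₁ → Fin m₁, μ * μ * ((agree f q.1 : ℝ) * agree g q.2) =
              μ ^ 2 * agree g q.2 * agree f q.1 := fun f => by ring
          simp only [hc]
          refine h.trans ?_
          gcongr
          exact hpt _ (agree_le _ _)
      _ = (m₁ : ℝ) ^ s₁ * (∑ g : Fin s₂ → Fin m₂, Real.exp (α * agree g q.2) +
            R * ∑ g : Fin s₂ → Fin m₂, Real.exp (θ * agree g q.2)) := by
          rw [← Finset.mul_sum, Finset.sum_add_distrib, ← Finset.mul_sum]
      _ ≤ (m₁ : ℝ) ^ s₁ * ((m₂ : ℝ) ^ s₂ * Real.exp (s₂ * (1 / m₂) * (Real.exp α - 1)) +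
            R * ((m₂ : ℝ) ^ s₂ * Real.exp (s₂ * (1 / m₂) * (Real.exp θ - 1)))) := by
          gcongr
          · exact sum_exp_agree_le hm₂ _ _
          · exact sum_exp_agree_le hm₂ _ _
      _ = (Real.exp (s₂ * (1 / m₂) * (Real.exp α - 1)) +
            R * Real.exp (s₂ * (1 / m₂) * (Real.exp θ - 1))) *
              ((m₁ : ℝ) ^ s₁ * (m₂ : ℝ) ^ s₂) := by ring
      _ ≤ B * ((m₁ : ℝ) ^ s₁ * (m₂ : ℝ) ^ s₂) := by gcongr
  calc _ ≤ ∑ _q : (Fin s₁ → Fin m₁) × (Fin s₂ → Fin m₂),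
        B * ((m₁ : ℝ) ^ s₁ * (m₂ : ℝ) ^ s₂) := Finset.sum_le_sum fun q _ => hq q
    _ = _ := by
      rw [Finset.sum_const, Finset.card_univ, nsmul_eq_mul, hcard]
      ring

/-! ### The truncated exponential moment bound -/

theorem exp_sub_one_le_two_mul {x : ℝ} (h0 : 0 ≤ x) (h1 : x ≤ 1) : Real.exp x - 1 ≤ 2 * x := by
  have h := Real.abs_exp_sub_one_sub_id_le (abs_le.2 ⟨by linarith, h1⟩)
  nlinarith [(abs_le.1 h).2]

theorem exp_sub_one_le_mul_exp (x : ℝ) : Real.exp x - 1 ≤ x * Real.exp x := by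
  have h := Real.add_one_le_exp (-x)
  have h2 : Real.exp (-x) * Real.exp x = 1 := by rw [← Real.exp_add]; simp
  nlinarith [Real.exp_pos x]

theorem exp_mul_sub_one_le {r x : ℝ} (h0 : 0 ≤ r) (h1 : r ≤ 1) :
    Real.exp (r * x) - 1 ≤ r * (Real.exp x - 1) := by
  have h := convexOn_exp.2 (Set.mem_univ 0) (Set.mem_univ x) (sub_nonneg.2 h1) h0 (by ring)
  simp only [smul_eq_mul, mul_zero, zero_add, Real.exp_zero, mul_one] at h
  linarith

theorem log_le_half {x : ℝ} (hx : 0 < x) : Real.log x ≤ x / 2 := by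
  have h := Real.log_le_sub_one_of_pos (half_pos hx)
  rw [Real.log_div hx.ne' two_ne_zero] at h
  linarith [Real.log_two_lt_d9]

theorem mul_exp_neg_add_log_le {c L₁ L₂ : ℝ} (hc : 4 * c ≤ 1) (hL₁ : 1 ≤ L₁)
    (hL₂ : 1 ≤ L₂) (hlog : Real.log L₁ ≤ L₂) :
    2 * c * (L₂ * Real.exp (-(L₁ / 2))) + Real.log L₁ ≤ L₂ + 1 := by
  have hE := Real.exp_pos (-(L₁ / 2))
  have key : ∀ z, L₂ * Real.exp (-(L₁ / 2)) ≤ z →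
      2 * c * (L₂ * Real.exp (-(L₁ / 2))) ≤ z / 2 := fun z hz => by
    have h0 : 0 ≤ L₂ * Real.exp (-(L₁ / 2)) := by positivity
    calc 2 * c * (L₂ * Real.exp (-(L₁ / 2))) ≤ 1 / 2 * (L₂ * Real.exp (-(L₁ / 2))) := by
          gcongr
          linarith
      _ ≤ z / 2 := by linarith
  rcases le_total L₂ L₁ with h | h
  · have h2 : L₂ * Real.exp (-(L₁ / 2)) ≤ 2 := by
      rw [Real.exp_neg, mul_inv_le_iff₀ (Real.exp_pos _)]
      linarith [Real.add_one_le_exp (L₁ / 2)]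
    linarith [key 2 h2]
  · have h2 : L₂ * Real.exp (-(L₁ / 2)) ≤ L₂ :=
      mul_le_of_le_one_right (by linarith) (Real.exp_le_one_iff.2 (by linarith))
    linarith [key L₂ h2, log_le_half (show 0 < L₁ by linarith)]

/-- Chernoff-type domination of the conditional second moment. The agreement count `k` of the
second coordinate is split at `v * k = 1`. -/
theorem exists_exp_domination {s₁ s₂ : ℕ} {p₁ p₂ L₁ L₂ v δ b : ℝ} (hs₂ : 1 ≤ s₂)
    (hp₁ : 0 < p₁) (hp₂ : 0 < p₂) (hp₁L : p₁ ≤ 2 * Real.exp (-L₁)) (hp₂L : p₂ ≤ 2 * Real.exp (-L₂))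
    (hL₁ : 1 ≤ L₁) (hL₂ : 1 ≤ L₂) (hlog₁ : Real.log L₁ ≤ L₂) (hlog₂ : Real.log L₂ ≤ L₁)
    (hb : s₁ * L₁ ≤ b * (s₂ * L₂)) (hv : 0 < v) (hδ : 0 < δ) (hδ' : δ ≤ 1 / 16)
    (hδb : 4 * (δ * b) ≤ 1) (hv₂ : v * s₂ ≤ δ * L₁) (hv₁ : v * s₁ ≤ δ * L₂)
    (hv₁₂ : s₁ * p₁ * (s₂ * p₂) * v ≤ δ) :
    ∃ α θ R : ℝ, 0 ≤ R ∧
      (∀ k : ℕ, k ≤ s₂ → Real.exp (s₁ * p₁ * (Real.exp (v * k) - 1)) ≤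
        Real.exp (α * k) + R * Real.exp (θ * k)) ∧
      Real.exp (s₂ * p₂ * (Real.exp α - 1)) + R * Real.exp (s₂ * p₂ * (Real.exp θ - 1)) ≤
        1 + 24 * δ := by
  have hs₂' : (1 : ℝ) ≤ s₂ := by exact_mod_cast hs₂
  have hs₂0 : (0 : ℝ) < s₂ := by linarith
  have hs₁0 : (0 : ℝ) ≤ s₁ := Nat.cast_nonneg _
  obtain ⟨K, hK⟩ : ∃ x, x = Real.log (1 / (2 * δ)) := ⟨_, rfl⟩
  obtain ⟨α, hα⟩ : ∃ x, x = 2 * (s₁ * p₁) * v := ⟨_, rfl⟩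
  obtain ⟨θ, hθ⟩ : ∃ x, x = L₂ - Real.log L₁ + K := ⟨_, rfl⟩
  obtain ⟨lam, hlam⟩ : ∃ x, x = s₁ * p₁ * (Real.exp (v * s₂) - 1) / s₂ := ⟨_, rfl⟩
  obtain ⟨k₁, hk₁⟩ : ∃ x, x = max 1 (1 / v) := ⟨_, rfl⟩
  have hα0 : 0 ≤ α := by rw [hα]; positivity
  have hα1 : α ≤ 1 := by
    have hL₂e : L₂ ≤ Real.exp L₁ := by rwa [← Real.log_le_iff_le_exp (by linarith)]
    have hee : Real.exp (-L₁) * Real.exp L₁ = 1 := by rw [← Real.exp_add]; simp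
    have hvs : v * s₁ ≤ δ * Real.exp L₁ := hv₁.trans (by gcongr)
    calc α = 2 * p₁ * (v * s₁) := by rw [hα]; ring
      _ ≤ 2 * (2 * Real.exp (-L₁)) * (δ * Real.exp L₁) := by
          gcongr
      _ = 4 * δ * (Real.exp (-L₁) * Real.exp L₁) := by ring
      _ ≤ 1 := by rw [hee]; linarith
  have hexpθ : Real.exp θ = Real.exp L₂ / L₁ * (1 / (2 * δ)) := by
    rw [hθ, Real.exp_add, Real.exp_sub, Real.exp_log (by linarith), hK, Real.exp_log (by positivity)]
  have hk1 : 1 ≤ k₁ := hk₁ ▸ le_max_left _ _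
  have hθk : s₂ * p₂ * Real.exp θ ≤ k₁ := by
    have hee : Real.exp (-L₂) * Real.exp L₂ = 1 := by rw [← Real.exp_add]; simp
    calc s₂ * p₂ * Real.exp θ ≤ s₂ * (2 * Real.exp (-L₂)) * Real.exp θ := by gcongr
      _ = s₂ / (δ * L₁) * (Real.exp (-L₂) * Real.exp L₂) := by rw [hexpθ]; field_simp
      _ = s₂ / (δ * L₁) := by rw [hee, mul_one]
      _ ≤ 1 / v := by
          rw [div_le_div_iff₀ (by positivity) hv]
          linarith
      _ ≤ k₁ := hk₁ ▸ le_max_right _ _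
  have hlamL : lam ≤ 2 * (δ * b) * (L₂ * Real.exp (-(L₁ / 2))) := by
    have h1 : Real.exp (v * s₂) - 1 ≤ δ * L₁ * Real.exp (L₁ / 2) := by
      refine (exp_sub_one_le_mul_exp _).trans ?_
      have h3 : δ * L₁ ≤ 1 / 16 * L₁ := by gcongr
      gcongr
      linarith
    have hee : Real.exp (-L₁) * Real.exp (L₁ / 2) = Real.exp (-(L₁ / 2)) := by
      rw [← Real.exp_add]; congr 1; ring
    rw [hlam, div_le_iff₀ hs₂0]
    have h0 : 0 ≤ Real.exp (v * s₂) - 1 := sub_nonneg.2 (Real.one_le_exp (by positivity))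
    calc s₁ * p₁ * (Real.exp (v * s₂) - 1)
        ≤ s₁ * (2 * Real.exp (-L₁)) * (δ * L₁ * Real.exp (L₁ / 2)) := by gcongr
      _ = 2 * δ * (s₁ * L₁) * (Real.exp (-L₁) * Real.exp (L₁ / 2)) := by ring
      _ ≤ 2 * δ * (b * (s₂ * L₂)) * Real.exp (-(L₁ / 2)) := by rw [hee]; gcongr
      _ = _ := by ring
  have hgap : K - 1 ≤ θ - lam := by
    have := mul_exp_neg_add_log_le (c := δ * b) hδb hL₁ hL₂ hlog₁
    linarith
  have hKe : Real.exp (-K) = 2 * δ := by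
    rw [Real.exp_neg, hK, Real.exp_log (by positivity)]; simp
  have he : Real.exp 1 < 2.7182818286 := Real.exp_one_lt_d9
  have he2 : Real.exp 2 < 8 := by
    have : Real.exp 2 = Real.exp 1 * Real.exp 1 := by rw [← Real.exp_add]; norm_num
    have h3 : Real.exp 1 * Real.exp 1 ≤ 2.8 * 2.8 := by gcongr <;> linarith
    linarith
  have hK2 : 2 ≤ K := by
    rw [hK, Real.le_log_iff_exp_le (by positivity), le_div_iff₀ (by positivity)]
    have h3 : Real.exp 2 * (2 * δ) ≤ 8 * (2 * δ) := by gcongr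
    linarith
  refine ⟨α, θ, Real.exp (-((θ - lam) * k₁)), (Real.exp_pos _).le, fun k hk => ?_, ?_⟩
  · rcases le_total (v * k) 1 with h | h
    · have h1 := exp_sub_one_le_two_mul (by positivity) h
      refine le_trans (Real.exp_le_exp.2 ?_) (le_add_of_nonneg_right (by positivity))
      calc s₁ * p₁ * (Real.exp (v * k) - 1) ≤ s₁ * p₁ * (2 * (v * k)) := by gcongr
        _ = α * k := by rw [hα]; ring
    · refine le_trans ?_ (le_add_of_nonneg_left (Real.exp_pos _).le)
      rw [← Real.exp_add]
      refine Real.exp_le_exp.2 ?_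
      have hk0 : k ≠ 0 := by
        rintro rfl
        norm_num at h
      have hkk : k₁ ≤ k := by
        rw [hk₁]
        refine max_le (by exact_mod_cast Nat.one_le_iff_ne_zero.2 hk0) ?_
        rw [div_le_iff₀ hv]
        linarith
      have hks : (k : ℝ) ≤ s₂ := by exact_mod_cast hk
      have h1 := exp_mul_sub_one_le (r := k / s₂) (x := v * s₂) (by positivity)
        ((div_le_one hs₂0).2 hks)
      have hkv : (k : ℝ) / s₂ * (v * s₂) = v * k := by field_simp
      rw [hkv] at h1
      have h2 : s₁ * p₁ * (Real.exp (v * k) - 1) ≤ lam * k := by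
        calc s₁ * p₁ * (Real.exp (v * k) - 1)
            ≤ s₁ * p₁ * (k / s₂ * (Real.exp (v * s₂) - 1)) := by gcongr
          _ = lam * k := by rw [hlam]; ring
      have h3 : 0 ≤ (θ - lam) * (k - k₁) := mul_nonneg (by linarith) (by linarith)
      linarith
  · have h1 : Real.exp (s₂ * p₂ * (Real.exp α - 1)) ≤ 1 + 8 * δ := by
      have h2 : s₂ * p₂ * (Real.exp α - 1) ≤ 4 * δ := by
        calc s₂ * p₂ * (Real.exp α - 1) ≤ s₂ * p₂ * (2 * α) := by
              gcongr
              exact exp_sub_one_le_two_mul hα0 hα1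
          _ = 4 * (s₁ * p₁ * (s₂ * p₂) * v) := by rw [hα]; ring
          _ ≤ 4 * δ := by gcongr
      have h3 := exp_sub_one_le_two_mul (show 0 ≤ 4 * δ by positivity) (by linarith)
      linarith [Real.exp_le_exp.2 h2]
    have h2 : Real.exp (-((θ - lam) * k₁)) * Real.exp (s₂ * p₂ * (Real.exp θ - 1)) ≤ 16 * δ := by
      rw [← Real.exp_add]
      calc Real.exp (-((θ - lam) * k₁) + s₂ * p₂ * (Real.exp θ - 1))
          ≤ Real.exp (2 - K) := by
            refine Real.exp_le_exp.2 ?_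
            have h3 : 0 ≤ (s₂ : ℝ) * p₂ := by positivity
            have h4 : (K - 1) * k₁ ≤ (θ - lam) * k₁ := by gcongr
            have h5 : 0 ≤ (K - 2) * (k₁ - 1) := mul_nonneg (by linarith) (by linarith)
            linarith
        _ = Real.exp 2 * (2 * δ) := by rw [sub_eq_add_neg, Real.exp_add, hKe]
        _ ≤ 8 * (2 * δ) := by gcongr
        _ = 16 * δ := by ring
    linarith

/-! ### Lower and upper bounds on the separation rate -/

theorem exists_block_embedding {s d : ℕ} (hs : 1 ≤ s) (hsd : s ≤ d) :
    ∃ m : ℕ, 0 < m ∧ Nonempty (Fin s × Fin m ↪ Fin d) ∧ 1 / (m : ℝ) ≤ 2 * (s / d) := by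
  have hm : 0 < d / s := Nat.div_pos hsd hs
  refine ⟨d / s, hm, Function.Embedding.nonempty_of_card_le ?_, ?_⟩
  · simpa using Nat.mul_div_le d s
  · have h1 : d < s * (d / s + 1) := by
      have := Nat.lt_mul_div_succ d hs
      simpa using this
    have h2 : d ≤ 2 * s * (d / s) := by nlinarith
    have h3 : (d : ℝ) ≤ 2 * s * (d / s : ℕ) := by exact_mod_cast h2
    have hm' : (0 : ℝ) < (d / s : ℕ) := by exact_mod_cast hm
    have hd : (0 : ℝ) < d := by exact_mod_cast (by omega : 0 < d)
    rw [← mul_div_assoc, div_le_div_iff₀ hm' hd]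
    linarith

theorem choose_le_exp_mul_log {s d : ℕ} (hs : 1 ≤ s) (hsd : s ≤ d) :
    (d.choose s : ℝ) ≤ Real.exp (s * (1 + Real.log ((d : ℝ) / s))) := by
  have hs0 : (0 : ℝ) < s := by exact_mod_cast hs
  have hd0 : (0 : ℝ) < d := by exact_mod_cast (by omega : 0 < d)
  calc (d.choose s : ℝ) ≤ (d : ℝ) ^ s / s.factorial := Nat.choose_le_pow_div s d
    _ = ((d : ℝ) / s) ^ s * ((s : ℝ) ^ s / s.factorial) := by
        rw [div_pow]
        field_simp
    _ ≤ ((d : ℝ) / s) ^ s * Real.exp s := by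
        gcongr
        exact Real.pow_div_factorial_le_exp s hs0.le s
    _ = Real.exp (s * (1 + Real.log ((d : ℝ) / s))) := by
        rw [mul_add, mul_one, Real.exp_add, Real.exp_nat_mul, Real.exp_log (by positivity), mul_comm]

theorem one_sub_le_risk_of_sq_le {d₁ d₂ s₁ s₂ : ℕ} {μ ε δ b : ℝ} (hs₁ : 1 ≤ s₁) (hsd₁ : s₁ ≤ d₁)
    (hs₂ : 1 ≤ s₂) (hsd₂ : s₂ ≤ d₂)
    (hL₁ : 1 ≤ Real.log ((d₁ : ℝ) / s₁)) (hL₂ : 1 ≤ Real.log ((d₂ : ℝ) / s₂))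
    (hlog₁ : Real.log (Real.log ((d₁ : ℝ) / s₁)) ≤ Real.log ((d₂ : ℝ) / s₂))
    (hlog₂ : Real.log (Real.log ((d₂ : ℝ) / s₂)) ≤ Real.log ((d₁ : ℝ) / s₁))
    (hb : s₁ * Real.log ((d₁ : ℝ) / s₁) ≤ b * (s₂ * Real.log ((d₂ : ℝ) / s₂)))
    (hμ : 0 < μ) (hε : 0 < ε) (hδ : 0 < δ) (hδ' : δ ≤ 1 / 16) (hδb : 4 * (δ * b) ≤ 1)
    (hδε : 24 * δ ≤ ε ^ 2)
    (hv₂ : μ ^ 2 * s₂ ≤ δ * Real.log ((d₁ : ℝ) / s₁))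
    (hv₁ : μ ^ 2 * s₁ ≤ δ * Real.log ((d₂ : ℝ) / s₂))
    (hv₁₂ : 4 * (μ ^ 2 * ((s₁ : ℝ) ^ 2 * (s₂ : ℝ) ^ 2)) ≤ δ * (d₁ * d₂))
    {Δ : (Fin d₁ → Fin d₂ → ℝ) → Bool} (hΔ : Measurable Δ) :
    1 - ε ≤ risk d₁ d₂ s₁ s₂ μ Δ := by
  have hs₁0 : (0 : ℝ) < s₁ := by exact_mod_cast hs₁
  have hs₂0 : (0 : ℝ) < s₂ := by exact_mod_cast hs₂
  have hd₁0 : (0 : ℝ) < d₁ := by exact_mod_cast (by omega : 0 < d₁)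
  have hd₂0 : (0 : ℝ) < d₂ := by exact_mod_cast (by omega : 0 < d₂)
  obtain ⟨m₁, hm₁, ⟨e₁⟩, hp₁⟩ := exists_block_embedding hs₁ hsd₁
  obtain ⟨m₂, hm₂, ⟨e₂⟩, hp₂⟩ := exists_block_embedding hs₂ hsd₂
  have hm₁0 : (0 : ℝ) < m₁ := by exact_mod_cast hm₁
  have hm₂0 : (0 : ℝ) < m₂ := by exact_mod_cast hm₂
  have hexp : ∀ s d : ℝ, 0 < s → 0 < d → Real.exp (-Real.log (d / s)) = s / d :=
    fun s d hs hd => by rw [Real.exp_neg, Real.exp_log (by positivity), inv_div]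
  have h12 : s₁ * (1 / (m₁ : ℝ)) * (s₂ * (1 / (m₂ : ℝ))) * μ ^ 2 ≤ δ := by
    calc s₁ * (1 / (m₁ : ℝ)) * (s₂ * (1 / (m₂ : ℝ))) * μ ^ 2
        ≤ s₁ * (2 * (s₁ / d₁)) * (s₂ * (2 * (s₂ / d₂))) * μ ^ 2 := by gcongr
      _ = 4 * (μ ^ 2 * ((s₁ : ℝ) ^ 2 * (s₂ : ℝ) ^ 2)) / (d₁ * d₂) := by field_simp; ring
      _ ≤ δ := by rwa [div_le_iff₀ (by positivity)]
  obtain ⟨α, θ, R, hR, hpt, hB⟩ := exists_exp_domination (s₁ := s₁) (s₂ := s₂)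
    (p₁ := 1 / m₁) (p₂ := 1 / m₂) hs₂ (by positivity) (by positivity)
    (by rwa [hexp _ _ hs₁0 hd₁0]) (by rwa [hexp _ _ hs₂0 hd₂0]) hL₁ hL₂ hlog₁ hlog₂ hb
    (pow_pos hμ 2) hδ hδ' hδb hv₂ hv₁ h12
  have : Nonempty (Fin m₁) := ⟨⟨0, hm₁⟩⟩
  have : Nonempty (Fin m₂) := ⟨⟨0, hm₂⟩⟩
  refine one_sub_le_risk hε hΔ
    (fun p : (Fin s₁ → Fin m₁) × (Fin s₂ → Fin m₂) =>
      blockMatrix μ (transversal e₁ p.1) (transversal e₂ p.2)) (fun p => ?_) ?_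
  · simpa only [card_transversal] using
      blockMatrix_mem_Theta μ (transversal e₁ p.1) (transversal e₂ p.2)
  · exact sum_exp_frob_transversal_le hm₁ hm₂ e₁ e₂ hpt hR (hB.trans (by linarith))

theorem mul_card_le_frob_of_mem_block {d₁ d₂ : ℕ} {μ : ℝ} {X : Fin d₁ → Fin d₂ → ℝ}
    {S₁ : Finset (Fin d₁)} {S₂ : Finset (Fin d₂)}
    (hX : ∀ i j, i ∈ S₁ → j ∈ S₂ → μ ≤ X i j) :
    S₁.card * S₂.card * μ ≤ frob (blockMatrix 1 S₁ S₂) X := by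
  rw [frob_blockMatrix_left]
  calc (S₁.card : ℝ) * S₂.card * μ = ∑ _i ∈ S₁, ∑ _j ∈ S₂, μ := by
        simp [mul_assoc]
    _ ≤ _ := Finset.sum_le_sum fun i hi => Finset.sum_le_sum fun j hj => by
        rw [one_mul]
        exact hX i j hi hj

theorem exists_sum_test {d₁ d₂ s₁ s₂ : ℕ} {μ : ℝ} (hd₁ : 0 < d₁) (hd₂ : 0 < d₂) (hμ : 0 < μ) :
    ∃ Δ : (Fin d₁ → Fin d₂ → ℝ) → Bool, Measurable Δ ∧ risk d₁ d₂ s₁ s₂ μ Δ ≤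
      2 * Real.exp (-(μ ^ 2 * ((s₁ : ℝ) ^ 2 * (s₂ : ℝ) ^ 2) / (8 * (d₁ * d₂)))) := by
  have hd₁0 : (0 : ℝ) < d₁ := by exact_mod_cast hd₁
  have hd₂0 : (0 : ℝ) < d₂ := by exact_mod_cast hd₂
  obtain ⟨Δ, hΔ, hr⟩ := exists_scan_test (s₁ := s₁) (s₂ := s₂) (μ := μ) (N := d₁ * d₂)
    (t := s₁ * s₂ * μ / 2) (by positivity) (by positivity)
    {blockMatrix 1 (Finset.univ : Finset (Fin d₁)) (Finset.univ : Finset (Fin d₂))}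
    (by
      intro w hw
      rw [Finset.mem_singleton.1 hw, frob_blockMatrix]
      simp)
    (by
      rintro X ⟨S₁, S₂, rfl, rfl, hX, hX0⟩
      refine ⟨_, Finset.mem_singleton_self _, ?_⟩
      have h1 := mul_card_le_frob_of_mem_block hX
      have h2 : frob (blockMatrix 1 S₁ S₂) X = frob (blockMatrix 1 Finset.univ Finset.univ) X := by
        simp only [frob, blockMatrix, Finset.mem_univ, and_self, if_true]
        refine Finset.sum_congr rfl fun i _ => Finset.sum_congr rfl fun j _ => ?_
        split_ifs with h
        · rfl
        · rw [hX0 i j h, mul_zero, mul_zero]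
      linarith)
  refine ⟨Δ, hΔ, hr.trans_eq ?_⟩
  rw [Finset.card_singleton, Nat.cast_one, one_mul]
  congr 3
  field_simp
  ring

theorem exists_submatrix_scan_test {d₁ d₂ s₁ s₂ : ℕ} {μ : ℝ} (hs₁ : 1 ≤ s₁) (hsd₁ : s₁ ≤ d₁)
    (hs₂ : 1 ≤ s₂) (hsd₂ : s₂ ≤ d₂) (hμ : 0 < μ) :
    ∃ Δ : (Fin d₁ → Fin d₂ → ℝ) → Bool, Measurable Δ ∧ risk d₁ d₂ s₁ s₂ μ Δ ≤
      2 * Real.exp (s₁ * (1 + Real.log ((d₁ : ℝ) / s₁)) + s₂ * (1 + Real.log ((d₂ : ℝ) / s₂)) -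
        μ ^ 2 * (s₁ * s₂) / 8) := by
  classical
  have hs₁0 : (0 : ℝ) < s₁ := by exact_mod_cast hs₁
  have hs₂0 : (0 : ℝ) < s₂ := by exact_mod_cast hs₂
  set 𝒲 : Finset (Fin d₁ → Fin d₂ → ℝ) :=
    ((Finset.univ : Finset (Fin d₁)).powersetCard s₁ ×ˢ
      (Finset.univ : Finset (Fin d₂)).powersetCard s₂).image fun p => blockMatrix 1 p.1 p.2 with hW
  have hcard : (𝒲.card : ℝ) ≤ Real.exp (s₁ * (1 + Real.log ((d₁ : ℝ) / s₁))) *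
      Real.exp (s₂ * (1 + Real.log ((d₂ : ℝ) / s₂))) := by
    have h1 : 𝒲.card ≤ d₁.choose s₁ * d₂.choose s₂ := by
      refine Finset.card_image_le.trans_eq ?_
      simp [Finset.card_product]
    calc (𝒲.card : ℝ) ≤ d₁.choose s₁ * d₂.choose s₂ := by exact_mod_cast h1
      _ ≤ _ := by
        gcongr
        · exact choose_le_exp_mul_log hs₁ hsd₁
        · exact choose_le_exp_mul_log hs₂ hsd₂
  obtain ⟨Δ, hΔ, hr⟩ := exists_scan_test (s₁ := s₁) (s₂ := s₂) (μ := μ) (N := s₁ * s₂)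
    (t := s₁ * s₂ * μ / 2) (by positivity) (by positivity) 𝒲
    (by
      intro w hw
      obtain ⟨⟨S₁, S₂⟩, hS, rfl⟩ := Finset.mem_image.1 hw
      obtain ⟨h₁, h₂⟩ := Finset.mem_product.1 hS
      rw [frob_blockMatrix]
      simp [(Finset.mem_powersetCard.1 h₁).2, (Finset.mem_powersetCard.1 h₂).2])
    (by
      rintro X ⟨S₁, S₂, h₁, h₂, hX, -⟩
      refine ⟨blockMatrix 1 S₁ S₂, Finset.mem_image.2 ⟨(S₁, S₂), ?_, rfl⟩, ?_⟩
      · simp [h₁, h₂]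
      · have h := mul_card_le_frob_of_mem_block hX
        rw [h₁, h₂] at h
        linarith)
  refine ⟨Δ, hΔ, hr.trans ?_⟩
  rw [sub_eq_add_neg, Real.exp_add, Real.exp_add]
  have ht : (s₁ * s₂ * μ / 2) ^ 2 / (2 * (s₁ * s₂)) = μ ^ 2 * (s₁ * s₂) / 8 := by
    field_simp
    ring
  rw [ht]
  gcongr

/-- If every detectable level is at least `√l` and `√u` is detectable, then
`l ≤ muStar ^ 2 ≤ u`. -/
theorem muStar_sq_bounds {η l u : ℝ} {d₁ d₂ s₁ s₂ : ℕ} (hu : 0 < u)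
    (hl : ∀ μ : ℝ, 0 < μ → μ ^ 2 < l → ∀ Δ : (Fin d₁ → Fin d₂ → ℝ) → Bool, Measurable Δ →
      η ≤ risk d₁ d₂ s₁ s₂ μ Δ)
    (htest : ∃ Δ : (Fin d₁ → Fin d₂ → ℝ) → Bool, Measurable Δ ∧
      risk d₁ d₂ s₁ s₂ (Real.sqrt u) Δ < η) :
    l ≤ muStar η d₁ d₂ s₁ s₂ ^ 2 ∧ muStar η d₁ d₂ s₁ s₂ ^ 2 ≤ u := by
  have hmem : Real.sqrt u ∈ {μ : ℝ | 0 < μ ∧ ∃ Δ : (Fin d₁ → Fin d₂ → ℝ) → Bool,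
    Measurable Δ ∧ risk d₁ d₂ s₁ s₂ μ Δ < η} := ⟨Real.sqrt_pos.2 hu, htest⟩
  have h0 : 0 ≤ muStar η d₁ d₂ s₁ s₂ := Real.sInf_nonneg fun μ hμ => hμ.1.le
  constructor
  · have h : Real.sqrt l ≤ muStar η d₁ d₂ s₁ s₂ := by
      refine le_csInf ⟨_, hmem⟩ ?_
      rintro μ ⟨hμ, Δ, hΔ, hr⟩
      by_contra hlt
      have h2 : μ ^ 2 < l := (Real.lt_sqrt hμ.le).1 (not_le.1 hlt)
      linarith [hl μ hμ h2 Δ hΔ]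
    exact (Real.sqrt_le_left h0).1 h
  · have h : muStar η d₁ d₂ s₁ s₂ ≤ Real.sqrt u := csInf_le ⟨0, fun μ hμ => hμ.1.le⟩ hmem
    calc muStar η d₁ d₂ s₁ s₂ ^ 2 ≤ Real.sqrt u ^ 2 := by gcongr
      _ = u := Real.sq_sqrt hu.le

/-- Recovery of the Butucea–Ingster rate (Corollary 1). -/
theorem butucea_ingster_rate (η a b : ℝ) (hη0 : 0 < η) (hη1 : η < 1)
    (ha : 0 < a) (hab : a ≤ b) :
    ∃ c C : ℝ, 0 < c ∧ 0 < C ∧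
      ∀ (d₁ d₂ s₁ s₂ : ℕ), 0 < d₁ → 0 < d₂ →
        1 ≤ s₁ → s₁ ≤ d₁ → 1 ≤ s₂ → s₂ ≤ d₂ →
        Real.exp 1 ≤ min ((d₁ : ℝ) / (s₁ : ℝ)) ((d₂ : ℝ) / (s₂ : ℝ)) →
        Real.log (Real.log ((d₁ : ℝ) / (s₁ : ℝ))) ≤ Real.log ((d₂ : ℝ) / (s₂ : ℝ)) →
        Real.log (Real.log ((d₂ : ℝ) / (s₂ : ℝ))) ≤ Real.log ((d₁ : ℝ) / (s₁ : ℝ)) →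
        a * ((s₂ : ℝ) * Real.log ((d₂ : ℝ) / (s₂ : ℝ))) ≤
          (s₁ : ℝ) * Real.log ((d₁ : ℝ) / (s₁ : ℝ)) →
        (s₁ : ℝ) * Real.log ((d₁ : ℝ) / (s₁ : ℝ)) ≤
          b * ((s₂ : ℝ) * Real.log ((d₂ : ℝ) / (s₂ : ℝ))) →
        c * min ((d₁ : ℝ) * (d₂ : ℝ) / ((s₁ : ℝ) ^ 2 * (s₂ : ℝ) ^ 2))
              ((1 / (s₂ : ℝ)) * Real.log ((d₁ : ℝ) / (s₁ : ℝ)) +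
                (1 / (s₁ : ℝ)) * Real.log ((d₂ : ℝ) / (s₂ : ℝ))) ≤
            (muStar η d₁ d₂ s₁ s₂) ^ 2 ∧
        (muStar η d₁ d₂ s₁ s₂) ^ 2 ≤
          C * min ((d₁ : ℝ) * (d₂ : ℝ) / ((s₁ : ℝ) ^ 2 * (s₂ : ℝ) ^ 2))
              ((1 / (s₂ : ℝ)) * Real.log ((d₁ : ℝ) / (s₁ : ℝ)) +
                (1 / (s₁ : ℝ)) * Real.log ((d₂ : ℝ) / (s₂ : ℝ))) := by
  set ε : ℝ := 1 - η with hε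
  have hε0 : 0 < ε := by linarith
  have hb : 0 < b := ha.trans_le hab
  obtain ⟨δ, hδ0, hδ16, hδb, hδε⟩ : ∃ δ : ℝ, 0 < δ ∧ δ ≤ 1 / 16 ∧ 4 * (δ * b) ≤ 1 ∧
      24 * δ ≤ ε ^ 2 := by
    refine ⟨min (1 / 16) (min (1 / (4 * b)) (ε ^ 2 / 24)), by positivity, min_le_left _ _, ?_, ?_⟩
    · have h : min (1 / 16) (min (1 / (4 * b)) (ε ^ 2 / 24)) ≤ 1 / (4 * b) :=
        (min_le_right _ _).trans (min_le_left _ _)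
      rw [le_div_iff₀ (by positivity)] at h
      linarith
    · have h : min (1 / 16) (min (1 / (4 * b)) (ε ^ 2 / 24)) ≤ ε ^ 2 / 24 :=
        (min_le_right _ _).trans (min_le_right _ _)
      linarith
  have hlog2 : 0 < Real.log (2 / η) := Real.log_pos (by rw [lt_div_iff₀ hη0]; linarith)
  have hη_exp : ∀ x : ℝ, x < -Real.log (2 / η) → 2 * Real.exp x < η := fun x hx => by
    have h : Real.exp x < η / 2 := by
      rw [← inv_div, ← Real.exp_log (show 0 < (2 / η)⁻¹ by positivity), Real.log_inv]
      exact Real.exp_lt_exp.2 hx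
    linarith
  refine ⟨δ / (4 + 1 / a + b), 24 + 8 * Real.log (2 / η), by positivity, by positivity, ?_⟩
  intro d₁ d₂ s₁ s₂ hd₁ hd₂ hs₁ hsd₁ hs₂ hsd₂ he hlog₁ hlog₂ hal hbl
  have hs₁0 : (0 : ℝ) < s₁ := by exact_mod_cast hs₁
  have hs₂0 : (0 : ℝ) < s₂ := by exact_mod_cast hs₂
  have hd₁0 : (0 : ℝ) < d₁ := by exact_mod_cast hd₁
  have hd₂0 : (0 : ℝ) < d₂ := by exact_mod_cast hd₂
  have hL₁ : 1 ≤ Real.log ((d₁ : ℝ) / s₁) :=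
    (Real.le_log_iff_exp_le (by positivity)).2 (he.trans (min_le_left _ _))
  have hL₂ : 1 ≤ Real.log ((d₂ : ℝ) / s₂) :=
    (Real.le_log_iff_exp_le (by positivity)).2 (he.trans (min_le_right _ _))
  obtain ⟨T₁, hT₁⟩ : ∃ x, x = (d₁ : ℝ) * (d₂ : ℝ) / ((s₁ : ℝ) ^ 2 * (s₂ : ℝ) ^ 2) := ⟨_, rfl⟩
  obtain ⟨T₂, hT₂⟩ : ∃ x, x = (1 / (s₂ : ℝ)) * Real.log ((d₁ : ℝ) / (s₁ : ℝ)) +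
    (1 / (s₁ : ℝ)) * Real.log ((d₂ : ℝ) / (s₂ : ℝ)) := ⟨_, rfl⟩
  rw [← hT₁, ← hT₂]
  have hT₁0 : 0 < T₁ := by rw [hT₁]; positivity
  have hT₂0 : 0 < T₂ := by rw [hT₂]; positivity
  have hT₁mul : T₁ * ((s₁ : ℝ) ^ 2 * (s₂ : ℝ) ^ 2) = d₁ * d₂ := by
    rw [hT₁]
    field_simp
  have hT₂mul : T₂ * (s₁ * s₂) =
      s₁ * Real.log ((d₁ : ℝ) / s₁) + s₂ * Real.log ((d₂ : ℝ) / s₂) := by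
    rw [hT₂]
    field_simp
  refine muStar_sq_bounds (by positivity) (fun μ hμ hμc Δ hΔ => ?_) ?_
  · set D : ℝ := 4 + 1 / a + b with hD
    have hD0 : 0 < D := by positivity
    have hD4 : 4 ≤ D := by
      have : 0 < 1 / a := by positivity
      linarith
    have hDa : 1 + 1 / a ≤ D := by linarith
    have hDb : 1 + b ≤ D := by
      have : 0 < 1 / a := by positivity
      linarith
    have hμ₁ : D * μ ^ 2 ≤ δ * T₁ := by
      have h : μ ^ 2 ≤ δ / D * T₁ :=
        hμc.le.trans (mul_le_mul_of_nonneg_left (min_le_left _ _) (by positivity))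
      rwa [div_mul_eq_mul_div, le_div_iff₀ hD0, mul_comm] at h
    have hμ₂ : D * μ ^ 2 ≤ δ * T₂ := by
      have h : μ ^ 2 ≤ δ / D * T₂ :=
        hμc.le.trans (mul_le_mul_of_nonneg_left (min_le_right _ _) (by positivity))
      rwa [div_mul_eq_mul_div, le_div_iff₀ hD0, mul_comm] at h
    have hμ₂' : D * μ ^ 2 * (s₁ * s₂) ≤
        δ * (s₁ * Real.log ((d₁ : ℝ) / s₁) + s₂ * Real.log ((d₂ : ℝ) / s₂)) := by
      rw [← hT₂mul, ← mul_assoc δ]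
      gcongr
    have hal' : s₂ * Real.log ((d₂ : ℝ) / s₂) ≤ 1 / a * (s₁ * Real.log ((d₁ : ℝ) / s₁)) := by
      rw [div_mul_eq_mul_div, one_mul, le_div_iff₀ ha]
      linarith
    have hrisk := one_sub_le_risk_of_sq_le hs₁ hsd₁ hs₂ hsd₂ hL₁ hL₂ hlog₁ hlog₂ hbl hμ hε0 hδ0
      hδ16 hδb hδε ?_ ?_ ?_ hΔ
    · linarith
    · have h : D * (s₁ * (μ ^ 2 * s₂)) ≤ D * (s₁ * (δ * Real.log ((d₁ : ℝ) / s₁))) := by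
        calc D * (s₁ * (μ ^ 2 * s₂)) = D * μ ^ 2 * (s₁ * s₂) := by ring
          _ ≤ δ * (s₁ * Real.log ((d₁ : ℝ) / s₁) +
                1 / a * (s₁ * Real.log ((d₁ : ℝ) / s₁))) := hμ₂'.trans (by gcongr)
          _ = (1 + 1 / a) * (s₁ * (δ * Real.log ((d₁ : ℝ) / s₁))) := by ring
          _ ≤ D * (s₁ * (δ * Real.log ((d₁ : ℝ) / s₁))) := by gcongr
      exact le_of_mul_le_mul_left (le_of_mul_le_mul_left h hD0) hs₁0
    · have h : D * (s₂ * (μ ^ 2 * s₁)) ≤ D * (s₂ * (δ * Real.log ((d₂ : ℝ) / s₂))) := by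
        calc D * (s₂ * (μ ^ 2 * s₁)) = D * μ ^ 2 * (s₁ * s₂) := by ring
          _ ≤ δ * (b * (s₂ * Real.log ((d₂ : ℝ) / s₂)) +
                s₂ * Real.log ((d₂ : ℝ) / s₂)) := hμ₂'.trans (by gcongr)
          _ = (1 + b) * (s₂ * (δ * Real.log ((d₂ : ℝ) / s₂))) := by ring
          _ ≤ D * (s₂ * (δ * Real.log ((d₂ : ℝ) / s₂))) := by gcongr
      exact le_of_mul_le_mul_left (le_of_mul_le_mul_left h hD0) hs₂0
    · calc 4 * (μ ^ 2 * ((s₁ : ℝ) ^ 2 * (s₂ : ℝ) ^ 2))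
          ≤ D * (μ ^ 2 * ((s₁ : ℝ) ^ 2 * (s₂ : ℝ) ^ 2)) := by gcongr
        _ = D * μ ^ 2 * ((s₁ : ℝ) ^ 2 * (s₂ : ℝ) ^ 2) := by ring
        _ ≤ δ * T₁ * ((s₁ : ℝ) ^ 2 * (s₂ : ℝ) ^ 2) := by gcongr
        _ = δ * (d₁ * d₂) := by rw [mul_assoc, hT₁mul]
  · set C : ℝ := 24 + 8 * Real.log (2 / η) with hC
    have hC0 : 0 < C := by positivity
    have hu : 0 < C * min T₁ T₂ := by positivity
    have hsqrt := Real.sqrt_pos.2 hu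
    rcases le_total T₁ T₂ with h | h
    · obtain ⟨Δ, hΔ, hr⟩ := exists_sum_test (s₁ := s₁) (s₂ := s₂) hd₁ hd₂ hsqrt
      refine ⟨Δ, hΔ, hr.trans_lt (hη_exp _ ?_)⟩
      rw [Real.sq_sqrt hu.le, min_eq_left h, mul_assoc C, hT₁mul]
      have : C * ((d₁ : ℝ) * d₂) / (8 * (d₁ * d₂)) = C / 8 := by field_simp
      rw [this]
      linarith
    · obtain ⟨Δ, hΔ, hr⟩ := exists_submatrix_scan_test hs₁ hsd₁ hs₂ hsd₂ hsqrt
      refine ⟨Δ, hΔ, hr.trans_lt (hη_exp _ ?_)⟩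
      rw [Real.sq_sqrt hu.le, min_eq_right h, mul_assoc C, hT₂mul]
      have hs₁1 : (1 : ℝ) ≤ s₁ := by exact_mod_cast hs₁
      have hB₁ : (s₁ : ℝ) ≤ s₁ * Real.log ((d₁ : ℝ) / s₁) := le_mul_of_one_le_right hs₁0.le hL₁
      have hB₂ : (s₂ : ℝ) ≤ s₂ * Real.log ((d₂ : ℝ) / s₂) := le_mul_of_one_le_right hs₂0.le hL₂
      have hB : 1 ≤ s₁ * Real.log ((d₁ : ℝ) / s₁) + s₂ * Real.log ((d₂ : ℝ) / s₂) := by linarith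
      have hprod := le_mul_of_one_le_right (show 0 ≤ C / 8 - 2 by linarith) hB
      linarith
end

section
/- (Asymptotic suboptimality of the Butucea–Ingster rate.) Fix η ∈ (0,1) and α > 0, and let c₁, c₂ > 0 be sufficiently small constants. Let (d₁(n)), (d₂(n)), (s₁(n)), (s₂(n)) be sequences of positive integers tending to infinity with s₁(n) ≤ d₁(n), s₂(n) ≤ d₂(n), s₁(n)/d₁(n) → 0 and s₂(n)/d₂(n) → 0, and such that for every n: s₁(n)² > d₁(n)·s₂(n)·log d₂(n), s₁(n) ≤ c₁·d₁(n), s₂(n) ≤ c₂·d₂(n), d₁(n)/s₁(n) ≥ e·log(d₂(n)/s₂(n)), d₂(n) ≥ s₂(n)^{2+α}, and additionally log(d₂(n))/s₂(n)^{α} → 0. Then μ*(n)/μ_BI(n) → 0 as n → ∞, where μ*(n) is the minimax separation rate for the parameters (s₁(n), s₂(n), d₁(n), d₂(n)) and μ_BI(n)² = min( d₁(n)d₂(n)/(s₁(n)²s₂(n)²), 2·( (1/s₂(n))·log(d₁(n)/s₁(n)) + (1/s₁(n))·log(d₂(n)/s₂(n)) ) ). -/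
open MeasureTheory ProbabilityTheory

open Filter

open scoped NNReal

theorem hasSubgaussianMGF_gaussianReal_sub_mean (m : ℝ) (v : ℝ≥0) :
    HasSubgaussianMGF (fun x => x - m) v (gaussianReal m v) := by
  rw [← HasSubgaussianMGF.id_map_iff (by fun_prop), gaussianReal_map_sub_const, sub_self]
  refine ⟨fun t => integrable_exp_mul_gaussianReal t, fun t => ?_⟩
  rw [mgf_id_gaussianReal]
  simp

instance isProbabilityMeasure_Pmeas (d₁ d₂ : ℕ) (X : Fin d₁ → Fin d₂ → ℝ) :
    IsProbabilityMeasure (Pmeas d₁ d₂ X) := by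
  unfold Pmeas
  infer_instance

/-- Centred column sums are sub-Gaussian with variance proxy the number of rows. -/
theorem hasSubgaussianMGF_column_sum {d₁ d₂ : ℕ} (X : Fin d₁ → Fin d₂ → ℝ) (j : Fin d₂) :
    HasSubgaussianMGF (fun y => ∑ i, (y i j - X i j)) (d₁ : ℝ≥0) (Pmeas d₁ d₂ X) := by
  have hindep : iIndepFun (fun (i : Fin d₁) (y : Fin d₁ → Fin d₂ → ℝ) => y i j - X i j)
      (Pmeas d₁ d₂ X) :=
    iIndepFun_pi (X := fun (i : Fin d₁) (r : Fin d₂ → ℝ) => r j - X i j)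
      fun i => Measurable.aemeasurable (by fun_prop)
  have hentry : ∀ i ∈ Finset.univ, HasSubgaussianMGF
      (fun y : Fin d₁ → Fin d₂ → ℝ => y i j - X i j) 1 (Pmeas d₁ d₂ X) := by
    intro i _
    have hmap : (Pmeas d₁ d₂ X).map (fun y => y i j) = gaussianReal (X i j) 1 :=
      ((measurePreserving_eval (fun j => gaussianReal (X i j) 1) j).comp
        (measurePreserving_eval
          (fun i => Measure.pi fun j => gaussianReal (X i j) 1) i)).map_eq
    have h := hasSubgaussianMGF_gaussianReal_sub_mean (X i j) 1
    rw [← hmap] at h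
    exact HasSubgaussianMGF.of_map (Measurable.aemeasurable (by fun_prop)) h
  simpa using HasSubgaussianMGF.sum_of_iIndepFun hindep hentry

/-- The test rejecting when some column sum reaches the level `t`. -/
noncomputable def maxColumnTest (d₁ d₂ : ℕ) (t : ℝ) (y : Fin d₁ → Fin d₂ → ℝ) : Bool :=
  open Classical in decide (∃ j, t ≤ ∑ i, y i j)

theorem measurable_maxColumnTest (d₁ d₂ : ℕ) (t : ℝ) : Measurable (maxColumnTest d₁ d₂ t) := by
  refine measurable_to_bool ?_
  have h : maxColumnTest d₁ d₂ t ⁻¹' {true} = ⋃ j, {y | t ≤ ∑ i, y i j} := by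
    ext y
    simp [maxColumnTest]
  rw [h]
  exact MeasurableSet.iUnion fun j => measurableSet_le measurable_const (by fun_prop)

theorem risk_maxColumnTest_le {d₁ d₂ s₁ s₂ : ℕ} {μ t : ℝ} (ht : 0 ≤ t) (hs₂ : 1 ≤ s₂)
    (hμ : 2 * t ≤ s₁ * μ) :
    risk d₁ d₂ s₁ s₂ μ (maxColumnTest d₁ d₂ t) ≤
      ((d₂ : ℝ) + 1) * Real.exp (-t ^ 2 / (2 * d₁)) := by
  have hnull : (Pmeas d₁ d₂ 0).real {y | maxColumnTest d₁ d₂ t y = true} ≤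
      d₂ * Real.exp (-t ^ 2 / (2 * d₁)) := by
    have hset : {y | maxColumnTest d₁ d₂ t y = true} = ⋃ j, {y | t ≤ ∑ i, y i j} := by
      ext y
      simp [maxColumnTest]
    rw [hset]
    calc (Pmeas d₁ d₂ 0).real (⋃ j, {y | t ≤ ∑ i, y i j})
        ≤ ∑ j, (Pmeas d₁ d₂ 0).real {y | t ≤ ∑ i, y i j} := measureReal_iUnion_fintype_le _
      _ ≤ ∑ _j : Fin d₂, Real.exp (-t ^ 2 / (2 * d₁)) := by
          refine Finset.sum_le_sum fun j _ => ?_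
          simpa using (hasSubgaussianMGF_column_sum (0 : Fin d₁ → Fin d₂ → ℝ) j).measure_ge_le ht
      _ = d₂ * Real.exp (-t ^ 2 / (2 * d₁)) := by simp
  have halt : (⨆ X ∈ Theta d₁ d₂ s₁ s₂ μ,
      (Pmeas d₁ d₂ X {y | maxColumnTest d₁ d₂ t y = false}).toReal) ≤
        Real.exp (-t ^ 2 / (2 * d₁)) := by
    refine Real.iSup_le (fun X => Real.iSup_le ?_ (Real.exp_nonneg _)) (Real.exp_nonneg _)
    rintro ⟨S₁, S₂, hS₁, hS₂, hge, hzero⟩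
    obtain ⟨j, hj⟩ := Finset.card_pos.mp (show 0 < S₂.card by omega)
    have hsum : s₁ * μ ≤ ∑ i, X i j := by
      calc s₁ * μ = ∑ _i ∈ S₁, μ := by simp [hS₁]
        _ ≤ ∑ i ∈ S₁, X i j := Finset.sum_le_sum fun i hi => hge i j hi hj
        _ = ∑ i, X i j := Finset.sum_subset (Finset.subset_univ _) fun i _ hi =>
            hzero i j fun h => hi h.1
    refine le_trans (measureReal_mono fun y hy => ?_)
      ((hasSubgaussianMGF_column_sum X j).neg.measure_ge_le ht)
    have hy' : ∀ j, ∑ i, y i j < t := by simpa [maxColumnTest] using hy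
    have := hy' j
    simp only [Set.mem_ofPred_eq, Pi.neg_apply, Finset.sum_sub_distrib]
    linarith
  unfold risk
  rw [measureReal_def] at hnull
  linarith

theorem muStar_nonneg (η : ℝ) (d₁ d₂ s₁ s₂ : ℕ) : 0 ≤ muStar η d₁ d₂ s₁ s₂ :=
  Real.sInf_nonneg fun _ h => h.1.le

theorem muStar_le {η : ℝ} {d₁ d₂ s₁ s₂ : ℕ} (hd₁ : 1 ≤ d₁) (hd₂ : 2 ≤ d₂) (hs₁ : 1 ≤ s₁)
    (hs₂ : 1 ≤ s₂) (hη : 2 / (d₂ : ℝ) < η) :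
    muStar η d₁ d₂ s₁ s₂ ≤ 4 * Real.sqrt (d₁ * Real.log d₂ / (s₁ : ℝ) ^ 2) := by
  have hd₁' : (1 : ℝ) ≤ d₁ := by exact_mod_cast hd₁
  have hd₂' : (2 : ℝ) ≤ d₂ := by exact_mod_cast hd₂
  have hs₁' : (1 : ℝ) ≤ s₁ := by exact_mod_cast hs₁
  have hlog : 0 < Real.log d₂ := Real.log_pos (by linarith)
  refine csInf_le ⟨0, fun _ h => h.1.le⟩
    ⟨by positivity, maxColumnTest d₁ d₂ (2 * Real.sqrt (d₁ * Real.log d₂)),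
      measurable_maxColumnTest _ _ _, ?_⟩
  refine (risk_maxColumnTest_le (by positivity) hs₂ (le_of_eq ?_)).trans_lt ?_
  · rw [Real.sqrt_div (by positivity), Real.sqrt_sq (by positivity)]
    field_simp
    norm_num
  · have hexp : Real.exp (-(2 * Real.sqrt (d₁ * Real.log d₂)) ^ 2 / (2 * d₁)) =
        ((d₂ : ℝ) ^ 2)⁻¹ := by
      rw [mul_pow, Real.sq_sqrt (by positivity)]
      have : -(2 ^ 2 * ((d₁ : ℝ) * Real.log d₂)) / (2 * d₁) = -(2 * Real.log d₂) := by
        field_simp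
      rw [this, Real.exp_neg, two_mul, Real.exp_add, Real.exp_log (by linarith), sq]
    rw [hexp]
    refine lt_of_le_of_lt ?_ hη
    rw [← div_eq_mul_inv, div_le_div_iff₀ (by positivity) (by positivity)]
    nlinarith

theorem div_sqrt_min_le {m V A B a b : ℝ} (hm : m ≤ 4 * Real.sqrt V) (hA : 0 < A) (hB : 0 < B)
    (ha : V ≤ a * A) (hb : V ≤ b * B) (ha0 : 0 ≤ a) (hb0 : 0 ≤ b) :
    m / Real.sqrt (min A B) ≤ 4 * Real.sqrt (a + b) := by
  have hmin : 0 < min A B := lt_min hA hB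
  rw [div_le_iff₀ (Real.sqrt_pos.mpr hmin), mul_assoc, ← Real.sqrt_mul (by positivity)]
  refine hm.trans (mul_le_mul_of_nonneg_left (Real.sqrt_le_sqrt ?_) (by norm_num))
  rcases min_cases A B with ⟨h, -⟩ | ⟨h, -⟩ <;> rw [h]
  · nlinarith [mul_nonneg hb0 hA.le]
  · nlinarith [mul_nonneg ha0 hB.le]

/-- Asymptotic suboptimality of the Butucea–Ingster rate (Proposition 3):
μ*(n)/μ_BI(n) → 0. -/
theorem asymptotic_suboptimality (η α : ℝ) (hη0 : 0 < η) (hη1 : η < 1)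
    (hα : 0 < α) :
    ∃ c₁ c₂ : ℝ, 0 < c₁ ∧ 0 < c₂ ∧
      ∀ (d₁ d₂ s₁ s₂ : ℕ → ℕ),
        Tendsto (fun n => d₁ n) atTop atTop →
        Tendsto (fun n => d₂ n) atTop atTop →
        Tendsto (fun n => s₁ n) atTop atTop →
        Tendsto (fun n => s₂ n) atTop atTop →
        (∀ n, 1 ≤ s₁ n) → (∀ n, s₁ n ≤ d₁ n) →
        (∀ n, 1 ≤ s₂ n) → (∀ n, s₂ n ≤ d₂ n) →
        Tendsto (fun n => (s₁ n : ℝ) / (d₁ n : ℝ)) atTop (nhds 0) →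
        Tendsto (fun n => (s₂ n : ℝ) / (d₂ n : ℝ)) atTop (nhds 0) →
        (∀ n, (d₁ n : ℝ) * (s₂ n : ℝ) * Real.log (d₂ n : ℝ) < (s₁ n : ℝ) ^ 2) →
        (∀ n, (s₁ n : ℝ) ≤ c₁ * (d₁ n : ℝ)) →
        (∀ n, (s₂ n : ℝ) ≤ c₂ * (d₂ n : ℝ)) →
        (∀ n, Real.exp 1 * Real.log ((d₂ n : ℝ) / (s₂ n : ℝ)) ≤
          (d₁ n : ℝ) / (s₁ n : ℝ)) →
        (∀ n, (s₂ n : ℝ) ^ ((2 : ℝ) + α) ≤ (d₂ n : ℝ)) →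
        Tendsto (fun n => Real.log (d₂ n : ℝ) / (s₂ n : ℝ) ^ α) atTop (nhds 0) →
        Tendsto (fun n =>
          muStar η (d₁ n) (d₂ n) (s₁ n) (s₂ n) /
            Real.sqrt (min
              ((d₁ n : ℝ) * (d₂ n : ℝ) / ((s₁ n : ℝ) ^ 2 * (s₂ n : ℝ) ^ 2))
              (2 * ((1 / (s₂ n : ℝ)) * Real.log ((d₁ n : ℝ) / (s₁ n : ℝ)) +
                (1 / (s₁ n : ℝ)) * Real.log ((d₂ n : ℝ) / (s₂ n : ℝ))))))
          atTop (nhds 0) := by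
  refine ⟨1, 1, one_pos, one_pos, ?_⟩
  intro d₁ d₂ s₁ s₂ _ hd₂ _ _ hs₁ hsd₁ hs₂ hsd₂ hr₁ _ hreg _ _ _ hpow hlim
  have hlogr : Tendsto (fun n => (2 * Real.log ((d₁ n : ℝ) / (s₁ n : ℝ)))⁻¹) atTop (nhds 0) := by
    have hpos : ∀ᶠ n in atTop, (s₁ n : ℝ) / (d₁ n : ℝ) ∈ Set.Ioi (0 : ℝ) := by
      refine Eventually.of_forall fun n => ?_
      have h₁ : (0 : ℝ) < s₁ n := by exact_mod_cast hs₁ n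
      have h₂ : (0 : ℝ) < d₁ n := by exact_mod_cast (hs₁ n).trans (hsd₁ n)
      exact div_pos h₁ h₂
    have hinv := (tendsto_nhdsWithin_iff.mpr ⟨hr₁, hpos⟩).inv_tendsto_nhdsGT_zero
    have h :=
      ((Real.tendsto_log_atTop.comp hinv).const_mul_atTop (two_pos (α := ℝ))).inv_tendsto_atTop
    exact h.congr fun n => by simp
  have hbound : Tendsto (fun n => 4 * Real.sqrt (Real.log (d₂ n : ℝ) / (s₂ n : ℝ) ^ α +
      (2 * Real.log ((d₁ n : ℝ) / (s₁ n : ℝ)))⁻¹)) atTop (nhds 0) := by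
    simpa using ((hlim.add hlogr).sqrt).const_mul 4
  have hsmall : Tendsto (fun n => 2 / (d₂ n : ℝ)) atTop (nhds 0) :=
    (tendsto_natCast_atTop_atTop.comp hd₂).const_div_atTop 2
  have hr₁' : ∀ᶠ n in atTop, (s₁ n : ℝ) / (d₁ n : ℝ) < 1 := hr₁.eventually_lt_const one_pos
  refine squeeze_zero' (Eventually.of_forall fun n =>
    div_nonneg (muStar_nonneg _ _ _ _ _) (Real.sqrt_nonneg _)) ?_ hbound
  filter_upwards [hsmall.eventually_lt_const hη0, hd₂.eventually_ge_atTop 2, hr₁']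
    with n hn hn₂ hn₁
  have p₁ : (1 : ℝ) ≤ s₁ n := by exact_mod_cast hs₁ n
  have p₂ : (1 : ℝ) ≤ s₂ n := by exact_mod_cast hs₂ n
  have q₁ : (1 : ℝ) ≤ d₁ n := by exact_mod_cast (hs₁ n).trans (hsd₁ n)
  have q₂ : (2 : ℝ) ≤ d₂ n := by exact_mod_cast hn₂
  have hle₂ : (s₂ n : ℝ) ≤ d₂ n := by exact_mod_cast hsd₂ n
  have hlog₁ : 0 < Real.log ((d₁ n : ℝ) / (s₁ n : ℝ)) := by
    refine Real.log_pos ?_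
    rw [div_lt_one (by positivity)] at hn₁
    rwa [one_lt_div (by positivity)]
  have hlog₂ : 0 ≤ Real.log ((d₂ n : ℝ) / (s₂ n : ℝ)) :=
    Real.log_nonneg ((one_le_div (by positivity)).mpr hle₂)
  have hlogd : 0 < Real.log (d₂ n : ℝ) := Real.log_pos (by linarith)
  refine div_sqrt_min_le
    (muStar_le ((hs₁ n).trans (hsd₁ n)) hn₂ (hs₁ n) (hs₂ n) hn)
    (by positivity) (by positivity) ?_ ?_ (by positivity) (by positivity)
  · have hp := hpow n
    rw [Real.rpow_add (by positivity), Real.rpow_two] at hp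
    have hsα : 0 < (s₂ n : ℝ) ^ α := by positivity
    rw [div_mul_div_comm, div_le_div_iff₀ (by positivity) (by positivity)]
    have hc : 0 ≤ (d₁ n : ℝ) * Real.log (d₂ n) * (s₁ n : ℝ) ^ 2 := by positivity
    nlinarith [mul_le_mul_of_nonneg_left hp hc]
  · have hV : (d₁ n : ℝ) * Real.log (d₂ n) / (s₁ n : ℝ) ^ 2 ≤ 1 / (s₂ n : ℝ) := by
      rw [div_le_div_iff₀ (by positivity) (by positivity)]
      linarith [hreg n]
    refine hV.trans ?_
    rw [inv_mul_eq_div, mul_div_mul_left _ _ two_ne_zero, le_div_iff₀ hlog₁]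
    have : 0 ≤ 1 / (s₁ n : ℝ) * Real.log ((d₂ n : ℝ) / (s₂ n : ℝ)) := by positivity
    linarith
end
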